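/- arXiv:cond-mat/0208065 — 4 statements merged into one kernel-verified Lean document; each statement's English description precedes it below -/
import Mathlib

section
/- For every β > 0, every N ∈ ℕ and every integer m with 0 ≤ m ≤ N, the canonical Gibbs probability satisfies the lower bound P_N({n : N'(n) ≥ m}) ≥ P_N({n : N'(n) = 0}) · exp(−β m (ε 1 − ε 0)). -/
open scoped BigOperators

noncomputable section

/-- The particle number of a configuration `n : ℕ →₀ ℕ`. -/
def particleNumber (n : ℕ →₀ ℕ) : ℕ := n.sum fun _ k => k

/-- The energy of a configuration `n`, with one-particle levels `ε`. -/
def energy (ε : ℕ → ℝ) (n : ℕ →₀ ℕ) : ℝ := n.sum fun j k => (k : ℝ) * ε j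

/-- The canonical partition function of `N` bosons at inverse temperature `β`. -/
def Z (ε : ℕ → ℝ) (β : ℝ) (N : ℕ) : ℝ :=
  ∑' n : {n : ℕ →₀ ℕ // particleNumber n = N}, Real.exp (-β * energy ε n)

/-- The canonical Gibbs probability of the set `A` of configurations, among configurations
with particle number `N`. -/
def P (ε : ℕ → ℝ) (β : ℝ) (N : ℕ) (A : Set (ℕ →₀ ℕ)) : ℝ :=
  (∑' n : {n : ℕ →₀ ℕ // particleNumber n = N ∧ n ∈ A},
      Real.exp (-β * energy ε n)) / Z ε β N

theorem particleNumber_add (n k : ℕ →₀ ℕ) :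
    particleNumber (n + k) = particleNumber n + particleNumber k :=
  Finsupp.sum_add_index' (fun _ => rfl) fun _ _ _ => rfl

theorem particleNumber_single (j k : ℕ) : particleNumber (Finsupp.single j k) = k :=
  Finsupp.sum_single_index rfl

theorem particleNumber_eq_zero_iff {n : ℕ →₀ ℕ} : particleNumber n = 0 ↔ n = 0 :=
  Finsupp.degree_eq_zero_iff n

theorem energy_add (ε : ℕ → ℝ) (n k : ℕ →₀ ℕ) :
    energy ε (n + k) = energy ε n + energy ε k :=
  Finsupp.sum_add_index' (by simp) fun _ _ _ => by push_cast; ring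

theorem energy_single (ε : ℕ → ℝ) (j k : ℕ) :
    energy ε (Finsupp.single j k) = k * ε j :=
  Finsupp.sum_single_index (by simp)

theorem exists_eq_add_single_of_particleNumber_eq_succ {N : ℕ} {n : ℕ →₀ ℕ}
    (hn : particleNumber n = N + 1) :
    ∃ (j : ℕ) (k : ℕ →₀ ℕ), particleNumber k = N ∧ n = k + Finsupp.single j 1 := by
  have hne : n ≠ 0 := by
    rintro rfl
    simp [particleNumber] at hn
  obtain ⟨j, hj⟩ := Finsupp.ne_iff.mp hne
  have hle : Finsupp.single j 1 ≤ n :=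
    Finsupp.single_le_iff.mpr (Nat.one_le_iff_ne_zero.mpr hj)
  have hsub : n = (n - Finsupp.single j 1) + Finsupp.single j 1 := (tsub_add_cancel_of_le hle).symm
  refine ⟨j, n - Finsupp.single j 1, ?_, hsub⟩
  rw [hsub, particleNumber_add, particleNumber_single] at hn
  omega

theorem eq_single_zero_of_particleNumber_le {N : ℕ} {n : ℕ →₀ ℕ}
    (hn : particleNumber n = N) (h : N ≤ n 0) : n = Finsupp.single 0 N := by
  have hsplit := Finsupp.single_add_erase 0 n
  have hsum := congrArg particleNumber hsplit
  rw [particleNumber_add, particleNumber_single, hn] at hsum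
  have herase : n.erase 0 = 0 := particleNumber_eq_zero_iff.mp (by omega)
  have h0 : n 0 = N := by omega
  rw [← hsplit, herase, add_zero, h0]

/-- The Boltzmann weights of the configurations of `N` particles are summable. -/
theorem summable_exp_neg_energy {ε : ℕ → ℝ} {β : ℝ}
    (h : Summable fun j => Real.exp (-β * ε j)) (N : ℕ) :
    Summable fun n : {n : ℕ →₀ ℕ // particleNumber n = N} => Real.exp (-β * energy ε n) := by
  induction N with
  | zero =>
    have : Subsingleton {n : ℕ →₀ ℕ // particleNumber n = 0} :=
      ⟨fun a b => Subtype.ext <| by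
        rw [particleNumber_eq_zero_iff.mp a.2, particleNumber_eq_zero_iff.mp b.2]⟩
    exact Summable.of_finite
  | succ N ih =>
    choose j k hk hn using fun n : {n : ℕ →₀ ℕ // particleNumber n = N + 1} =>
      exists_eq_add_single_of_particleNumber_eq_succ n.2
    let g : {n : ℕ →₀ ℕ // particleNumber n = N + 1} →
        ℕ × {n : ℕ →₀ ℕ // particleNumber n = N} := fun n => (j n, ⟨k n, hk n⟩)
    have hg : Function.Injective g := by
      intro a b hab
      simp only [g, Prod.mk.injEq, Subtype.mk.injEq] at hab
      exact Subtype.ext (by rw [hn a, hn b, hab.1, hab.2])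
    have hprod := h.mul_of_nonneg ih (fun _ => (Real.exp_pos _).le) fun _ => (Real.exp_pos _).le
    refine (hprod.comp_injective hg).congr fun n => ?_
    simp only [Function.comp_apply, g]
    rw [← Real.exp_add, hn n, energy_add, energy_single]
    congr 1
    push_cast
    ring

theorem summable_exp_neg_energy_mem {ε : ℕ → ℝ} {β : ℝ}
    (h : Summable fun j => Real.exp (-β * ε j)) (N : ℕ) (A : Set (ℕ →₀ ℕ)) :
    Summable fun n : {n : ℕ →₀ ℕ // particleNumber n = N ∧ n ∈ A} =>
      Real.exp (-β * energy ε n) := by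
  let i : {n : ℕ →₀ ℕ // particleNumber n = N ∧ n ∈ A} →
      {n : ℕ →₀ ℕ // particleNumber n = N} := fun n => ⟨n.1, n.2.1⟩
  have hi : Function.Injective i := fun _ _ hab => Subtype.ext (Subtype.mk.inj hab)
  exact ((summable_exp_neg_energy h N).comp_injective hi).congr fun _ => rfl

/-- For every `β > 0`, every `N` and every `m` with `0 ≤ m ≤ N`, the canonical Gibbs
probability satisfies
`P_N(N' ≥ m) ≥ P_N(N' = 0) * exp (-β m (ε 1 - ε 0))`,
where `N'(n) = N - n 0` is the number of particles in excited states. -/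
theorem prob_excited_ge_lower_bound (ε : ℕ → ℝ) (hmono : Monotone ε) (hgap : ε 0 < ε 1)
    (htrace : ∀ β : ℝ, 0 < β → Summable fun j => Real.exp (-β * ε j))
    (β : ℝ) (hβ : 0 < β) (N m : ℕ) (hm : m ≤ N) :
    P ε β N {n : ℕ →₀ ℕ | m ≤ N - n 0} ≥
      P ε β N {n : ℕ →₀ ℕ | N - n 0 = 0} * Real.exp (-β * m * (ε 1 - ε 0)) := by
  have hZ : 0 ≤ Z ε β N := tsum_nonneg fun _ => (Real.exp_pos _).le
  have hground : (∑' n : {n : ℕ →₀ ℕ // particleNumber n = N ∧ n ∈ {n : ℕ →₀ ℕ | N - n 0 = 0}},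
      Real.exp (-β * energy ε n)) = Real.exp (-β * (N * ε 0)) := by
    rw [tsum_eq_single ⟨Finsupp.single 0 N, particleNumber_single 0 N, by simp⟩, energy_single]
    intro n hne
    exact absurd (Subtype.ext (eq_single_zero_of_particleNumber_le n.2.1
      (Nat.sub_eq_zero_iff_le.mp n.2.2))) hne
  have hexcited : Real.exp (-β * ((N - m : ℕ) * ε 0 + m * ε 1)) ≤
      ∑' n : {n : ℕ →₀ ℕ // particleNumber n = N ∧ n ∈ {n : ℕ →₀ ℕ | m ≤ N - n 0}},
        Real.exp (-β * energy ε n) := by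
    have hnum : particleNumber (Finsupp.single 0 (N - m) + Finsupp.single 1 m) = N := by
      rw [particleNumber_add, particleNumber_single, particleNumber_single]
      omega
    have hzero : (Finsupp.single 0 (N - m) + Finsupp.single 1 m : ℕ →₀ ℕ) 0 = N - m := by simp
    have hmem : Finsupp.single 0 (N - m) + Finsupp.single 1 m ∈
        {n : ℕ →₀ ℕ | m ≤ N - n 0} := by
      rw [Set.mem_ofPred_eq, hzero]
      omega
    have hle := (summable_exp_neg_energy_mem (htrace β hβ) N _).le_tsum ⟨_, hnum, hmem⟩ fun _ _ => (Real.exp_pos _).le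
    rwa [energy_add, energy_single, energy_single] at hle
  unfold P
  rw [ge_iff_le, div_mul_eq_mul_div, hground, ← Real.exp_add]
  refine div_le_div_of_nonneg_right (le_trans (le_of_eq ?_) hexcited) hZ
  rw [Nat.cast_sub hm]
  congr 1
  ring
end
end

section
/- For every β > 0, every μ with 0 ≤ μ < ε 1 − ε 0, every N ∈ ℕ and every integer m with 0 ≤ m ≤ N, the canonical Gibbs probability satisfies the upper bound P_N({n : N'(n) ≥ m}) ≤ P_N({n : N'(n) = 0}) · Q(β,μ) · exp(−β μ m). -/
open scoped BigOperators

noncomputable section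

/-- `Q(β,μ) = ∏_{j=1}^∞ (1 - exp (-β (ε j - ε 0 - μ)))⁻¹`. -/
def Q (ε : ℕ → ℝ) (β μ : ℝ) : ℝ :=
  ∏' j : ℕ, (1 - Real.exp (-β * (ε (j + 1) - ε 0 - μ)))⁻¹

lemma particleNumber_eq_sum_range {n : ℕ →₀ ℕ} {M : ℕ} (h : n.support ⊆ Finset.range (M + 1)) :
    particleNumber n = n 0 + ∑ j ∈ Finset.range M, n (j + 1) := by
  rw [particleNumber, Finsupp.sum_of_support_subset n h _ (by simp), Finset.sum_range_succ',
    add_comm]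

lemma energy_eq_sum_range (ε : ℕ → ℝ) {n : ℕ →₀ ℕ} {M : ℕ}
    (h : n.support ⊆ Finset.range (M + 1)) :
    energy ε n = n 0 * ε 0 + ∑ j ∈ Finset.range M, (n (j + 1) : ℝ) * ε (j + 1) := by
  rw [energy, Finsupp.sum_of_support_subset n h _ (by simp), Finset.sum_range_succ', add_comm]

/-- A configuration whose particles all sit in the ground level. -/
lemma eq_single_of_particleNumber_le {n : ℕ →₀ ℕ} (h : particleNumber n ≤ n 0) :
    n = Finsupp.single 0 (particleNumber n) := by
  ext j
  obtain ⟨M, hM⟩ := (n.support ∪ {j}).exists_nat_subset_range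
  have hs : n.support ⊆ Finset.range (M + 1) := fun i hi => by
    have := Finset.mem_range.1 (hM (Finset.mem_union_left _ hi))
    exact Finset.mem_range.2 (by omega)
  have hN := particleNumber_eq_sum_range hs
  rcases j with _ | j
  · simp only [Finsupp.single_eq_same]
    omega
  · have hj : j ∈ Finset.range M := by
      have := Finset.mem_range.1 (hM (Finset.mem_union_right _ (Finset.mem_singleton_self _)))
      exact Finset.mem_range.2 (by omega)
    have h1 := Finset.single_le_sum (f := fun j => n (j + 1)) (fun _ _ => Nat.zero_le _) hj
    simp only [Finsupp.single_apply]
    rw [if_neg (by omega)]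
    omega

lemma tsum_ground (ε : ℕ → ℝ) (β : ℝ) (N : ℕ) :
    ∑' n : {n : ℕ →₀ ℕ // particleNumber n = N ∧ n ∈ {n : ℕ →₀ ℕ | N - n 0 = 0}},
      Real.exp (-β * energy ε n) = Real.exp (-β * (N * ε 0)) := by
  let g : {n : ℕ →₀ ℕ // particleNumber n = N ∧ n ∈ {n : ℕ →₀ ℕ | N - n 0 = 0}} :=
    ⟨Finsupp.single 0 N, by simp [particleNumber]⟩
  have hg : ∀ n, n = g := by
    rintro ⟨n, rfl, hn⟩
    exact Subtype.ext (eq_single_of_particleNumber_le (Nat.sub_eq_zero_iff_le.1 hn))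
  rw [tsum_eq_single g fun n hn => absurd (hg n) hn]
  simp [g, energy]

/-- The Boltzmann weight of a configuration with at least `m` excited particles is bounded by
the product of the tilted weights of its excited levels. -/
lemma exp_energy_le (ε : ℕ → ℝ) {β μ : ℝ} (hβ : 0 ≤ β) (hμ : 0 ≤ μ) {n : ℕ →₀ ℕ} {m M : ℕ}
    (hs : n.support ⊆ Finset.range (M + 1)) (hn : m ≤ particleNumber n - n 0) :
    Real.exp (-β * energy ε n) ≤
      Real.exp (-β * (particleNumber n * ε 0)) * Real.exp (-β * μ * m) *
        ∏ j ∈ Finset.range M, Real.exp (-β * (ε (j + 1) - ε 0 - μ)) ^ n (j + 1) := by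
  have hN := particleNumber_eq_sum_range hs
  have hmS : (m : ℝ) ≤ ∑ j ∈ Finset.range M, (n (j + 1) : ℝ) := by
    exact_mod_cast (by omega : m ≤ ∑ j ∈ Finset.range M, n (j + 1))
  simp only [← Real.exp_nat_mul, ← Real.exp_sum, ← Real.exp_add]
  rw [Real.exp_le_exp, energy_eq_sum_range ε hs, hN]
  have hsum : ∑ j ∈ Finset.range M, (n (j + 1) : ℝ) * (-β * (ε (j + 1) - ε 0 - μ)) =
      -β * ∑ j ∈ Finset.range M, (n (j + 1) : ℝ) * ε (j + 1) +
        β * (ε 0 + μ) * ∑ j ∈ Finset.range M, (n (j + 1) : ℝ) := by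
    rw [Finset.mul_sum, Finset.mul_sum, ← Finset.sum_add_distrib]
    exact Finset.sum_congr rfl fun _ _ => by ring
  rw [hsum]
  push_cast
  nlinarith [mul_le_mul_of_nonneg_left hmS (mul_nonneg hβ hμ)]

lemma multipliable_inv_one_sub {x : ℕ → ℝ} {r : ℝ} (hx0 : ∀ j, 0 ≤ x j) (hxr : ∀ j, x j ≤ r)
    (hr : r < 1) (hx : Summable x) : Multipliable fun j => (1 - x j)⁻¹ := by
  have hpos : ∀ j, 0 < 1 - x j := fun j => by linarith [hxr j]
  have h : (fun j => (1 - x j)⁻¹) = fun j => 1 + x j / (1 - x j) := by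
    ext j
    have := (hpos j).ne'
    field_simp
    ring
  rw [h]
  refine Real.multipliable_one_add_of_summable
    (Summable.of_nonneg_of_le (fun j => div_nonneg (hx0 j) (hpos j).le) (fun j => ?_)
      (hx.mul_right (1 - r)⁻¹))
  rw [div_eq_mul_inv]
  have := hxr j
  gcongr
  exact hx0 j

lemma prod_le_tprod_of_one_le {f : ℕ → ℝ} (h1 : ∀ j, 1 ≤ f j) (hf : Multipliable f)
    (s : Finset ℕ) : ∏ j ∈ s, f j ≤ ∏' j, f j :=
  ge_of_tendsto hf.hasProd <| Filter.eventually_atTop.2 ⟨s, fun _ ht =>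
    Finset.prod_le_prod_of_subset_of_one_le ht (fun j _ => zero_le_one.trans (h1 j))
      fun j _ _ => h1 j⟩

/-- Summing the occupation-number weights of the excited levels over finitely many configurations
of fixed particle number gives at most the product of the geometric series of the levels. -/
lemma sum_prod_pow_le {x : ℕ → ℝ} (hx0 : ∀ j, 0 ≤ x j) (hx1 : ∀ j, x j < 1) (N M : ℕ)
    (s : Finset (ℕ →₀ ℕ)) (hN : ∀ n ∈ s, particleNumber n = N)
    (hs : ∀ n ∈ s, n.support ⊆ Finset.range (M + 1)) :
    ∑ n ∈ s, ∏ j ∈ Finset.range M, x j ^ n (j + 1) ≤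
      ∏ j ∈ Finset.range M, (1 - x j)⁻¹ := by
  let φ : (ℕ →₀ ℕ) → Fin M → ℕ := fun n i => n (i + 1)
  have hinj : Set.InjOn φ s := by
    intro n hn n' hn' h
    have hlev : ∀ j < M, n (j + 1) = n' (j + 1) := fun j hj => congrFun h ⟨j, hj⟩
    have h1 := particleNumber_eq_sum_range (hs n hn)
    have h2 := particleNumber_eq_sum_range (hs n' hn')
    rw [hN n hn, Finset.sum_congr rfl fun j hj => hlev j (Finset.mem_range.1 hj)] at h1
    rw [hN n' hn'] at h2
    ext j
    rcases j with _ | j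
    · omega
    · by_cases hj : j < M
      · exact hlev j hj
      · have hz : ∀ p ∈ s, p (j + 1) = 0 := fun p hp => by
          by_contra hne
          have := Finset.mem_range.1 (hs p hp (Finsupp.mem_support_iff.2 hne))
          omega
        rw [hz n hn, hz n' hn']
  have hbox : s.image φ ⊆ Fintype.piFinset fun _ : Fin M => Finset.range (N + 1) := by
    intro p hp
    obtain ⟨n, hn, rfl⟩ := Finset.mem_image.1 hp
    refine Fintype.mem_piFinset.2 fun i => Finset.mem_range.2 ?_
    have h1 := particleNumber_eq_sum_range (hs n hn)
    have h2 := Finset.single_le_sum (f := fun j => n (j + 1)) (fun _ _ => Nat.zero_le _)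
      (Finset.mem_range.2 i.2)
    rw [hN n hn] at h1
    dsimp only [φ] at h2 ⊢
    omega
  calc ∑ n ∈ s, ∏ j ∈ Finset.range M, x j ^ n (j + 1)
      = ∑ n ∈ s, ∏ i : Fin M, x i ^ φ n i :=
        Finset.sum_congr rfl fun n _ => Finset.prod_range fun j => x j ^ n (j + 1)
    _ = ∑ p ∈ s.image φ, ∏ i : Fin M, x i ^ p i := (Finset.sum_image (f := fun p => ∏ i : Fin M, x i ^ p i) hinj).symm
    _ ≤ ∑ p ∈ Fintype.piFinset fun _ : Fin M => Finset.range (N + 1), ∏ i : Fin M, x i ^ p i :=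
        Finset.sum_le_sum_of_subset_of_nonneg hbox fun _ _ _ =>
          Finset.prod_nonneg fun i _ => pow_nonneg (hx0 i) _
    _ = ∏ i : Fin M, ∑ k ∈ Finset.range (N + 1), x i ^ k :=
        (Finset.prod_univ_sum _ fun (i : Fin M) k => x i ^ k).symm
    _ ≤ ∏ i : Fin M, (1 - x i)⁻¹ := by
        refine Finset.prod_le_prod
          (fun i _ => Finset.sum_nonneg fun k _ => pow_nonneg (hx0 i) k) fun i _ => ?_
        rw [← tsum_geometric_of_lt_one (hx0 i) (hx1 i)]
        exact (summable_geometric_of_lt_one (hx0 i) (hx1 i)).sum_le_tsum _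
          fun k _ => pow_nonneg (hx0 i) k
    _ = ∏ j ∈ Finset.range M, (1 - x j)⁻¹ := (Finset.prod_range fun j => (1 - x j)⁻¹).symm

/-- For every `β > 0`, every `μ` with `0 ≤ μ < ε 1 - ε 0`, every `N` and every `m ≤ N`,
the canonical Gibbs probability satisfies
`P_N(N' ≥ m) ≤ P_N(N' = 0) * Q(β,μ) * exp (-β μ m)`,
where `N'(n) = N - n 0` is the number of particles in excited states. -/
theorem prob_excited_ge_upper_bound (ε : ℕ → ℝ) (hmono : Monotone ε) (hgap : ε 0 < ε 1)
    (htrace : ∀ β : ℝ, 0 < β → Summable fun j => Real.exp (-β * ε j))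
    (β : ℝ) (hβ : 0 < β) (μ : ℝ) (hμ0 : 0 ≤ μ) (hμ1 : μ < ε 1 - ε 0)
    (N m : ℕ) (hm : m ≤ N) :
    P ε β N {n : ℕ →₀ ℕ | m ≤ N - n 0} ≤
      P ε β N {n : ℕ →₀ ℕ | N - n 0 = 0} * Q ε β μ * Real.exp (-β * μ * m) := by
  set x : ℕ → ℝ := fun j => Real.exp (-β * (ε (j + 1) - ε 0 - μ)) with hx
  have hx0 : ∀ j, 0 ≤ x j := fun j => (Real.exp_pos _).le
  have hxr : ∀ j, x j ≤ x 0 := fun j => Real.exp_le_exp.2 <| by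
    nlinarith [mul_le_mul_of_nonneg_left (hmono (Nat.succ_le_succ (Nat.zero_le j))) hβ.le]
  have hr : x 0 < 1 := Real.exp_lt_one_iff.2 (by simp only [zero_add]; nlinarith)
  have hx1 : ∀ j, x j < 1 := fun j => (hxr j).trans_lt hr
  have hxs : Summable x := by
    refine (((summable_nat_add_iff 1).2 (htrace β hβ)).mul_left
      (Real.exp (β * (ε 0 + μ)))).congr fun j => ?_
    rw [← Real.exp_add, hx]
    congr 1
    ring
  have hf1 : ∀ j, 1 ≤ (1 - x j)⁻¹ := fun j =>
    (one_le_inv₀ (by linarith [hx1 j])).2 (by linarith [hx0 j])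
  have hprod : ∀ M, ∏ j ∈ Finset.range M, (1 - x j)⁻¹ ≤ Q ε β μ := fun M =>
    prod_le_tprod_of_one_le hf1 (multipliable_inv_one_sub hx0 hxr hr hxs) (Finset.range M)
  have hZ : 0 ≤ Z ε β N := tsum_nonneg fun _ => (Real.exp_pos _).le
  rw [P, P, tsum_ground, mul_assoc, div_mul_eq_mul_div]
  refine div_le_div_of_nonneg_right ?_ hZ
  refine Real.tsum_le_of_sum_le (fun _ => (Real.exp_pos _).le) fun t => ?_
  set s : Finset (ℕ →₀ ℕ) := t.map (Function.Embedding.subtype _) with hs_def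
  have hs : ∀ n ∈ s, particleNumber n = N ∧ m ≤ N - n 0 := fun n hn => by
    obtain ⟨p, -, rfl⟩ := Finset.mem_map.1 hn
    exact p.2
  obtain ⟨M, hM⟩ := (s.biUnion Finsupp.support).exists_nat_subset_range
  have hsupp : ∀ n ∈ s, n.support ⊆ Finset.range (M + 1) := fun n hn =>
    ((Finset.subset_biUnion_of_mem Finsupp.support hn).trans hM).trans
      (Finset.range_subset_range.2 M.le_succ)
  calc ∑ n ∈ t, Real.exp (-β * energy ε n)
      = ∑ n ∈ s, Real.exp (-β * energy ε n) := by simp [hs_def]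
    _ ≤ ∑ n ∈ s, Real.exp (-β * (N * ε 0)) * Real.exp (-β * μ * m) *
          ∏ j ∈ Finset.range M, x j ^ n (j + 1) := Finset.sum_le_sum fun n hn => by
        obtain ⟨rfl, hnm⟩ := hs n hn
        exact exp_energy_le ε hβ.le hμ0 (hsupp n hn) hnm
    _ ≤ Real.exp (-β * (N * ε 0)) * Real.exp (-β * μ * m) * Q ε β μ := by
        rw [← Finset.mul_sum]
        gcongr
        exact (sum_prod_pow_le hx0 hx1 N M s (fun n hn => (hs n hn).1) hsupp).trans (hprod M)
    _ = Real.exp (-β * (N * ε 0)) * (Q ε β μ * Real.exp (-β * μ * m)) := by ring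
end
end

section
/- For every β > 0 and every integer k ≥ 1, all moments of the number of excited particles stay bounded as N → ∞: limsup_{N→∞} ⟨(N')^k⟩_N ≤ inf over μ with 0 < μ < ε 1 − ε 0 of (Q(β,μ)/Q(β,0)) · ∑_{m=0}^∞ m^k exp(−β μ m) (the last series being convergent). -/
open scoped BigOperators
open Filter

noncomputable section

/-- The canonical expectation of `f` among configurations with particle number `N`. -/
def expect (ε : ℕ → ℝ) (β : ℝ) (N : ℕ) (f : (ℕ →₀ ℕ) → ℝ) : ℝ :=
  (∑' n : {n : ℕ →₀ ℕ // particleNumber n = N},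
      f n * Real.exp (-β * energy ε n)) / Z ε β N

/-- The finite-box expansion of a product of geometric sums over occupation numbers. -/
lemma sum_box_prod_pow (y : ℕ → ℝ) (s : Finset ℕ) (K : ℕ) :
    ∑ m ∈ s.finsupp (fun _ => Finset.range K), m.prod (fun j k => y j ^ k) =
      ∏ j ∈ s, ∑ k ∈ Finset.range K, y j ^ k := by
  classical
  rw [Finset.prod_sum, Finset.finsupp, Finset.sum_map]
  refine Finset.sum_congr (by congr!) fun p _ => ?_
  simp only [Function.Embedding.coeFn_mk]
  rw [Finsupp.prod_of_support_subset _ (Finsupp.support_indicator_subset s p) _ (by simp),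
    ← Finset.prod_attach]
  refine Finset.prod_congr rfl fun x _ => ?_
  rw [Finsupp.indicator_of_mem x.2]

/-- The infinite product of the geometric series of the `y j` is the sum, over all
configurations, of the associated monomials. -/
lemma hasSum_prod_pow {y : ℕ → ℝ} {r : ℝ} (hy0 : ∀ j, 0 ≤ y j) (hyr : ∀ j, y j ≤ r)
    (hr : r < 1) (hy : Summable y) :
    HasSum (fun m : ℕ →₀ ℕ => m.prod fun j k => y j ^ k) (∏' j, (1 - y j)⁻¹) := by
  classical
  have hlt : ∀ j, y j < 1 := fun j => (hyr j).trans_lt hr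
  have hpos : ∀ j, 0 < 1 - y j := fun j => sub_pos.2 (hlt j)
  have hone : ∀ j, 1 ≤ (1 - y j)⁻¹ := fun j =>
    (one_le_inv₀ (hpos j)).2 (by linarith [hy0 j])
  have hmul : Multipliable fun j => (1 - y j)⁻¹ := by
    have hs : Summable fun j => (1 - y j)⁻¹ - 1 := by
      refine Summable.of_nonneg_of_le (fun j => sub_nonneg.2 (hone j)) (fun j => ?_)
        (hy.mul_left (1 - r)⁻¹)
      have h1 : (1 - y j)⁻¹ - 1 = (1 - y j)⁻¹ * y j := by
        have := (hpos j).ne'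
        field_simp
        ring
      rw [h1]
      exact mul_le_mul_of_nonneg_right
        (inv_anti₀ (sub_pos.2 hr) (by linarith [hyr j])) (hy0 j)
    simpa using Real.multipliable_one_add_of_summable hs
  have hnonneg : ∀ m : ℕ →₀ ℕ, 0 ≤ m.prod fun j k => y j ^ k := fun m =>
    Finset.prod_nonneg fun j _ => pow_nonneg (hy0 j) _
  have hgeom : ∀ j, HasSum (fun k => y j ^ k) (1 - y j)⁻¹ := fun j =>
    hasSum_geometric_of_lt_one (hy0 j) (hlt j)
  refine hasSum_of_isLUB_of_nonneg _ hnonneg ⟨?_, fun B hB => ?_⟩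
  · rintro _ ⟨T, rfl⟩
    set s := T.sup Finsupp.support
    set K := T.sup fun m => m.sum (fun _ k => k) + 1
    have hsub : T ⊆ s.finsupp fun _ => Finset.range K := by
      intro m hm
      refine Finset.mem_finsupp_iff.2
        ⟨Finset.le_sup (f := Finsupp.support) hm, fun i _ => Finset.mem_range.2 ?_⟩
      have h1 : m.sum (fun _ k => k) + 1 ≤ K :=
        Finset.le_sup (f := fun m : ℕ →₀ ℕ => m.sum (fun _ k => k) + 1) hm
      have h2 : m i ≤ m.sum (fun _ k => k) := by
        by_cases hi : i ∈ m.support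
        · exact Finset.single_le_sum (f := fun i => m i) (fun _ _ => Nat.zero_le _) hi
        · simp [Finsupp.notMem_support_iff.1 hi]
      omega
    calc ∑ m ∈ T, m.prod (fun j k => y j ^ k)
        ≤ ∑ m ∈ s.finsupp (fun _ => Finset.range K), m.prod (fun j k => y j ^ k) :=
          Finset.sum_le_sum_of_subset_of_nonneg hsub fun m _ _ => hnonneg m
      _ = ∏ j ∈ s, ∑ k ∈ Finset.range K, y j ^ k := sum_box_prod_pow y s K
      _ ≤ ∏ j ∈ s, (1 - y j)⁻¹ :=
          Finset.prod_le_prod (fun j _ => Finset.sum_nonneg fun k _ => pow_nonneg (hy0 j) k)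
            fun j _ => sum_le_hasSum _ (fun k _ => pow_nonneg (hy0 j) k) (hgeom j)
      _ ≤ ∏' j, (1 - y j)⁻¹ := by
          refine ge_of_tendsto hmul.hasProd ?_
          filter_upwards [eventually_ge_atTop s] with t hst
          rw [← Finset.prod_sdiff hst]
          refine le_mul_of_one_le_left
            (Finset.prod_nonneg fun j _ => zero_le_one.trans (hone j)) ?_
          exact Finset.one_le_prod fun j _ => hone j
  · refine le_of_tendsto hmul.hasProd (Eventually.of_forall fun s => ?_)
    refine le_of_tendsto (tendsto_finsetProd s fun j _ => (hgeom j).tendsto_sum_nat)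
      (Eventually.of_forall fun K => ?_)
    rw [← sum_box_prod_pow]
    exact hB ⟨_, rfl⟩

/-- The configuration with `a` particles in the ground level and excited levels occupied
according to `m`. -/
def withGround (a : ℕ) (m : ℕ →₀ ℕ) : ℕ →₀ ℕ :=
  Finsupp.single 0 a + Finsupp.mapDomain Nat.succ m

/-- The occupation numbers of the excited levels. -/
def excited (n : ℕ →₀ ℕ) : ℕ →₀ ℕ :=
  n.comapDomain Nat.succ Nat.succ_injective.injOn

lemma withGround_zero (a : ℕ) (m : ℕ →₀ ℕ) : withGround a m 0 = a := by
  have : Finsupp.mapDomain Nat.succ m 0 = 0 :=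
    Finsupp.mapDomain_of_notMem_range _ _ (by simp)
  simp [withGround, this]

lemma withGround_succ (a : ℕ) (m : ℕ →₀ ℕ) (j : ℕ) : withGround a m (j + 1) = m j := by
  have : Finsupp.mapDomain Nat.succ m (j + 1) = m j :=
    Finsupp.mapDomain_apply Nat.succ_injective _ _
  simp [withGround, this]

lemma excited_withGround (a : ℕ) (m : ℕ →₀ ℕ) : excited (withGround a m) = m :=
  Finsupp.ext fun j => withGround_succ a m j

lemma withGround_excited (n : ℕ →₀ ℕ) : withGround (n 0) (excited n) = n := by
  ext j
  cases j with
  | zero => exact withGround_zero _ _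
  | succ j => exact withGround_succ _ _ j

lemma particleNumber_withGround (a : ℕ) (m : ℕ →₀ ℕ) :
    particleNumber (withGround a m) = a + particleNumber m := by
  unfold particleNumber withGround
  rw [Finsupp.sum_add_index' (by simp) (by simp), Finsupp.sum_single_index rfl,
    Finsupp.sum_mapDomain_index (by simp) (by simp)]

lemma energy_withGround (ε : ℕ → ℝ) (a : ℕ) (m : ℕ →₀ ℕ) :
    energy ε (withGround a m) = a * ε 0 + energy (fun j => ε (j + 1)) m := by
  unfold energy withGround
  rw [Finsupp.sum_add_index' (by simp) (by intros; push_cast; ring),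
    Finsupp.sum_single_index (by simp),
    Finsupp.sum_mapDomain_index (by simp) (by intros; push_cast; ring)]

lemma energy_sub_const (δ : ℕ → ℝ) (c : ℝ) (m : ℕ →₀ ℕ) :
    energy (fun j => δ j - c) m = energy δ m - c * particleNumber m := by
  simp only [energy, particleNumber, Finsupp.sum, Nat.cast_sum, Finset.mul_sum,
    ← Finset.sum_sub_distrib]
  exact Finset.sum_congr rfl fun _ _ => by ring

lemma exp_neg_mul_energy (δ : ℕ → ℝ) (β : ℝ) (m : ℕ →₀ ℕ) :
    Real.exp (-β * energy δ m) = m.prod fun j k => Real.exp (-β * δ j) ^ k := by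
  simp only [energy, Finsupp.sum, Finsupp.prod, Finset.mul_sum, Real.exp_sum,
    ← Real.exp_nat_mul]
  exact Finset.prod_congr rfl fun _ _ => by ring_nf

/-- Configurations of `N` particles correspond to configurations of at most `N` particles
in the excited levels. -/
def excitedEquiv (N : ℕ) :
    {n : ℕ →₀ ℕ // particleNumber n = N} ≃ {m : ℕ →₀ ℕ | particleNumber m ≤ N} where
  toFun n := ⟨excited n, by
    have h := particleNumber_withGround (n.1 0) (excited n)
    rw [withGround_excited, n.2] at h
    exact (Nat.le_add_left _ _).trans_eq h.symm⟩
  invFun m := ⟨withGround (N - particleNumber m.1) m, by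
    rw [particleNumber_withGround, Nat.sub_add_cancel m.2]⟩
  left_inv n := by
    have h := particleNumber_withGround (n.1 0) (excited n)
    rw [withGround_excited, n.2] at h
    ext1
    simp only [h, Nat.add_sub_cancel]
    exact withGround_excited n
  right_inv m := Subtype.ext (excited_withGround _ _)

/-- A canonical sum of a function of the number of excited particles, rewritten as a sum
over the occupations of the excited levels. -/
lemma tsum_canonical (ε : ℕ → ℝ) (β : ℝ) (N : ℕ) (f : ℕ → ℝ) :
    ∑' n : {n : ℕ →₀ ℕ // particleNumber n = N},
        f (N - n.1 0) * Real.exp (-β * energy ε n) =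
      Real.exp (-β * (N * ε 0)) * ∑' m : ℕ →₀ ℕ, {m | particleNumber m ≤ N}.indicator
        (fun m => f (particleNumber m) *
          Real.exp (-β * energy (fun j => ε (j + 1) - ε 0) m)) m := by
  rw [← tsum_subtype, ← tsum_mul_left, ← (excitedEquiv N).symm.tsum_eq]
  refine tsum_congr fun m => ?_
  have hm : particleNumber m.1 ≤ N := m.2
  have h0 : ((excitedEquiv N).symm m).1 = withGround (N - particleNumber m.1) m := rfl
  rw [h0, withGround_zero, Nat.sub_sub_self hm, energy_withGround, energy_sub_const,
    mul_left_comm, ← Real.exp_add, Nat.cast_sub hm]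
  ring_nf

/-- The generating function `Q(β,μ)` is the grand-canonical sum over the occupations of the
excited levels. -/
lemma hasSum_Q {ε : ℕ → ℝ} (hmono : Monotone ε) {β : ℝ} (hβ : 0 < β)
    (htrace : Summable fun j => Real.exp (-β * ε j)) {μ : ℝ} (hμ : μ < ε 1 - ε 0) :
    HasSum (fun m : ℕ →₀ ℕ => Real.exp (-β * energy (fun j => ε (j + 1) - ε 0 - μ) m))
      (Q ε β μ) := by
  simp only [exp_neg_mul_energy]
  refine hasSum_prod_pow (r := Real.exp (-β * (ε 1 - ε 0 - μ)))
    (fun j => (Real.exp_pos _).le) (fun j => Real.exp_le_exp.2 ?_) ?_ ?_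
  · have : ε 1 ≤ ε (j + 1) := hmono (by omega)
    nlinarith
  · rw [Real.exp_lt_one_iff]
    nlinarith
  · refine (((summable_nat_add_iff 1).2 htrace).mul_left (Real.exp (β * (ε 0 + μ)))).congr
      fun j => ?_
    rw [← Real.exp_add]
    ring_nf

lemma summable_pow_mul_exp_neg {β μ : ℝ} (hβ : 0 < β) (hμ : 0 < μ) (k : ℕ) :
    Summable fun m : ℕ => (m : ℝ) ^ k * Real.exp (-β * μ * m) := by
  have hr : ‖Real.exp (-β * μ)‖ < 1 := by
    rw [Real.norm_of_nonneg (Real.exp_pos _).le, Real.exp_lt_one_iff]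
    nlinarith [mul_pos hβ hμ]
  refine (summable_pow_mul_geometric_of_norm_lt_one k hr).congr fun m => ?_
  rw [← Real.exp_nat_mul]
  ring_nf

/-- The weight of the excited levels with at most `N` excited particles converges
to `Q(β,0)`. -/
lemma tendsto_tsum_indicator_Q {ε : ℕ → ℝ} (hmono : Monotone ε) (hgap : ε 0 < ε 1) {β : ℝ}
    (hβ : 0 < β) (htrace : Summable fun j => Real.exp (-β * ε j)) :
    Tendsto (fun N : ℕ => ∑' m : ℕ →₀ ℕ, {m | particleNumber m ≤ N}.indicator
        (fun m => Real.exp (-β * energy (fun j => ε (j + 1) - ε 0) m)) m) atTop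
      (nhds (Q ε β 0)) := by
  have hQ := hasSum_Q hmono hβ htrace (sub_pos.2 hgap)
  simp only [sub_zero] at hQ
  rw [← hQ.tsum_eq]
  refine tendsto_tsum_of_dominated_convergence hQ.summable (fun m => ?_)
    (Eventually.of_forall fun N m => ?_)
  · refine tendsto_const_nhds.congr' ?_
    filter_upwards [eventually_ge_atTop (particleNumber m)] with N hN
    simp [Set.indicator, hN]
  · rw [Real.norm_of_nonneg (Set.indicator_nonneg (fun _ _ => (Real.exp_pos _).le) m)]
    exact Set.indicator_le_self' (fun _ _ => (Real.exp_pos _).le) m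

/-- The unnormalised moments of the number of excited particles are bounded uniformly
in `N`. -/
lemma tsum_indicator_pow_le {ε : ℕ → ℝ} (hmono : Monotone ε) {β : ℝ} (hβ : 0 < β)
    (htrace : Summable fun j => Real.exp (-β * ε j)) (k N : ℕ) {μ : ℝ} (hμ0 : 0 < μ)
    (hμ : μ < ε 1 - ε 0) :
    ∑' m : ℕ →₀ ℕ, {m | particleNumber m ≤ N}.indicator
        (fun m => (particleNumber m : ℝ) ^ k *
          Real.exp (-β * energy (fun j => ε (j + 1) - ε 0) m)) m ≤
      (∑' m : ℕ, (m : ℝ) ^ k * Real.exp (-β * μ * m)) * Q ε β μ := by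
  have hQ := hasSum_Q hmono hβ htrace hμ
  have hS := summable_pow_mul_exp_neg hβ hμ0 k
  have hle : ∀ m : ℕ →₀ ℕ, {m | particleNumber m ≤ N}.indicator
      (fun m => (particleNumber m : ℝ) ^ k *
        Real.exp (-β * energy (fun j => ε (j + 1) - ε 0) m)) m ≤
      (∑' m : ℕ, (m : ℝ) ^ k * Real.exp (-β * μ * m)) *
        Real.exp (-β * energy (fun j => ε (j + 1) - ε 0 - μ) m) := by
    intro m
    refine (Set.indicator_le_self' (fun _ _ => by positivity) m).trans ?_
    have hfac : Real.exp (-β * energy (fun j => ε (j + 1) - ε 0) m) =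
        Real.exp (-β * μ * particleNumber m) *
          Real.exp (-β * energy (fun j => ε (j + 1) - ε 0 - μ) m) := by
      rw [energy_sub_const _ μ, ← Real.exp_add]
      congr 1
      ring
    rw [hfac, ← mul_assoc]
    exact mul_le_mul_of_nonneg_right
      (hS.le_tsum (particleNumber m) fun _ _ => by positivity) (Real.exp_pos _).le
  rw [← hQ.tsum_eq, ← tsum_mul_left]
  have hsum := hQ.summable.mul_left (∑' m : ℕ, (m : ℝ) ^ k * Real.exp (-β * μ * m))
  exact Summable.tsum_le_tsum hle (Summable.of_nonneg_of_le
    (fun m => Set.indicator_nonneg (fun _ _ => by positivity) m) hle hsum) hsum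

lemma one_le_Q_zero {ε : ℕ → ℝ} (hmono : Monotone ε) (hgap : ε 0 < ε 1) {β : ℝ}
    (hβ : 0 < β) (htrace : Summable fun j => Real.exp (-β * ε j)) : 1 ≤ Q ε β 0 := by
  simpa [energy] using le_hasSum (hasSum_Q hmono hβ htrace (sub_pos.2 hgap)) 0
    fun _ _ => (Real.exp_pos _).le

lemma expect_pow_eq (ε : ℕ → ℝ) (β : ℝ) (N k : ℕ) :
    expect ε β N (fun n : ℕ →₀ ℕ => ((N - n 0 : ℕ) : ℝ) ^ k) =
      (∑' m : ℕ →₀ ℕ, {m | particleNumber m ≤ N}.indicator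
        (fun m => (particleNumber m : ℝ) ^ k *
          Real.exp (-β * energy (fun j => ε (j + 1) - ε 0) m)) m) /
      ∑' m : ℕ →₀ ℕ, {m | particleNumber m ≤ N}.indicator
        (fun m => Real.exp (-β * energy (fun j => ε (j + 1) - ε 0) m)) m := by
  have h1 := tsum_canonical ε β N fun l => (l : ℝ) ^ k
  have h2 := tsum_canonical ε β N fun _ => 1
  simp only [one_mul] at h2
  rw [expect, Z, h1, h2, mul_div_mul_left _ _ (Real.exp_pos _).ne']

/-- For every `β > 0` and every `k ≥ 1`, all moments of the number `N'(n) = N - n 0`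
of excited particles stay bounded as `N → ∞`:
`limsup_N ⟨(N')^k⟩_N ≤ inf_{0 < μ < ε 1 - ε 0} (Q(β,μ)/Q(β,0)) * ∑_{m} m^k exp (-β μ m)`,
the last series being convergent. -/
theorem limsup_moments_excited_particles_le (ε : ℕ → ℝ) (hmono : Monotone ε)
    (hgap : ε 0 < ε 1)
    (htrace : ∀ β : ℝ, 0 < β → Summable fun j => Real.exp (-β * ε j))
    (β : ℝ) (hβ : 0 < β) (k : ℕ) (hk : 1 ≤ k) :
    (∀ μ : ℝ, 0 < μ → μ < ε 1 - ε 0 →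
      Summable fun m : ℕ => (m : ℝ) ^ k * Real.exp (-β * μ * m)) ∧
    Filter.limsup
        (fun N : ℕ => expect ε β N fun n : ℕ →₀ ℕ => ((N - n 0 : ℕ) : ℝ) ^ k) atTop ≤
      ⨅ μ : {μ : ℝ // 0 < μ ∧ μ < ε 1 - ε 0},
        (Q ε β μ / Q ε β 0) * ∑' m : ℕ, (m : ℝ) ^ k * Real.exp (-β * μ * m) := by
  refine ⟨fun μ hμ0 _ => summable_pow_mul_exp_neg hβ hμ0 k, ?_⟩
  have hne : Nonempty {μ : ℝ // 0 < μ ∧ μ < ε 1 - ε 0} :=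
    ⟨⟨(ε 1 - ε 0) / 2, by linarith, by linarith⟩⟩
  refine le_ciInf fun ⟨μ, hμ0, hμ⟩ => ?_
  have hlim : Tendsto (fun N : ℕ =>
      ((∑' m : ℕ, (m : ℝ) ^ k * Real.exp (-β * μ * m)) * Q ε β μ) /
        ∑' m : ℕ →₀ ℕ, {m | particleNumber m ≤ N}.indicator
          (fun m => Real.exp (-β * energy (fun j => ε (j + 1) - ε 0) m)) m) atTop
      (nhds ((Q ε β μ / Q ε β 0) * ∑' m : ℕ, (m : ℝ) ^ k * Real.exp (-β * μ * m))) := by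
    rw [div_mul_eq_mul_div, mul_comm (Q ε β μ)]
    exact tendsto_const_nhds.div (tendsto_tsum_indicator_Q hmono hgap hβ (htrace β hβ))
      (zero_lt_one.trans_le (one_le_Q_zero hmono hgap hβ (htrace β hβ))).ne'
  have hden : ∀ N : ℕ, 0 ≤ ∑' m : ℕ →₀ ℕ, {m | particleNumber m ≤ N}.indicator
      (fun m => Real.exp (-β * energy (fun j => ε (j + 1) - ε 0) m)) m := fun N =>
    tsum_nonneg fun m => Set.indicator_nonneg (fun _ _ => (Real.exp_pos _).le) m
  simp only [expect_pow_eq]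
  rw [← hlim.limsup_eq]
  refine limsup_le_limsup (Eventually.of_forall fun N => ?_) ?_ hlim.isBoundedUnder_le
  · exact div_le_div_of_nonneg_right
      (tsum_indicator_pow_le hmono hβ (htrace β hβ) k N hμ0 hμ) (hden N)
  · refine (isBoundedUnder_of ⟨0, fun N => ?_⟩ :
      IsBoundedUnder (· ≥ ·) atTop _).isCoboundedUnder_le
    exact div_nonneg (tsum_nonneg fun m => Set.indicator_nonneg
      (fun _ _ => by positivity) m) (hden N)
end
end

section
/- For every β > 0 there is a constant c(β) > 0 such that for all N ∈ ℕ and every index j ≥ 1, the canonical Gibbs expectation of the occupation of the j-th excited level satisfies ⟨n j⟩_N ≤ c(β) · exp(−β(ε j − ε 0)). -/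
open scoped BigOperators

noncomputable section

theorem particleNumber_add_single (m : ℕ →₀ ℕ) (i : ℕ) :
    particleNumber (m + Finsupp.single i 1) = particleNumber m + 1 := by
  simp [particleNumber, Finsupp.sum_add_index']

theorem energy_add_single (ε : ℕ → ℝ) (m : ℕ →₀ ℕ) (i : ℕ) :
    energy ε (m + Finsupp.single i 1) = energy ε m + ε i := by
  rw [energy, Finsupp.sum_add_index' (by simp) (by intros; push_cast; ring)]
  simp [energy]

theorem apply_le_particleNumber (n : ℕ →₀ ℕ) (j : ℕ) : n j ≤ particleNumber n := by
  by_cases hj : j ∈ n.support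
  · exact Finset.single_le_sum (f := fun i => n i) (fun _ _ => Nat.zero_le _) hj
  · simp [Finsupp.notMem_support_iff.mp hj]

/-- Move one particle from level `j` to level `0`. -/
def lowerParticle (j : ℕ) (n : ℕ →₀ ℕ) : ℕ →₀ ℕ :=
  n - Finsupp.single j 1 + Finsupp.single 0 1

theorem sub_single_add_single {n : ℕ →₀ ℕ} {j : ℕ} (h : 1 ≤ n j) :
    n - Finsupp.single j 1 + Finsupp.single j 1 = n :=
  tsub_add_cancel_of_le (Finsupp.single_le_iff.mpr h)

theorem particleNumber_lowerParticle {n : ℕ →₀ ℕ} {j : ℕ} (h : 1 ≤ n j) :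
    particleNumber (lowerParticle j n) = particleNumber n := by
  conv_rhs => rw [← sub_single_add_single h]
  rw [lowerParticle, particleNumber_add_single, particleNumber_add_single]

theorem energy_lowerParticle (ε : ℕ → ℝ) {n : ℕ →₀ ℕ} {j : ℕ} (h : 1 ≤ n j) :
    energy ε n = energy ε (lowerParticle j n) + (ε j - ε 0) := by
  conv_lhs => rw [← sub_single_add_single h]
  rw [lowerParticle, energy_add_single, energy_add_single]
  ring

theorem lowerParticle_apply_add_one {n : ℕ →₀ ℕ} {j : ℕ} (hj : 1 ≤ j) (h : 1 ≤ n j) :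
    lowerParticle j n j + 1 = n j := by
  have : (0 : ℕ) ≠ j := by omega
  simp [lowerParticle, Finsupp.single_eq_of_ne' this, h]

theorem lowerParticle_injOn (j : ℕ) : Set.InjOn (lowerParticle j) {n | 1 ≤ n j} := by
  intro n hn m hm h
  rw [← sub_single_add_single hn, ← sub_single_add_single hm, add_right_cancel h]

/-- Moving a particle from level `j` to level `0` bounds the unnormalised occupation of level `j`
by itself plus the partition function, times the Boltzmann factor of the gap. -/
theorem tsum_occupation_le (ε : ℕ → ℝ) (β : ℝ) (N : ℕ) {j : ℕ} (hj : 1 ≤ j)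
    (hw : Summable fun n : {n : ℕ →₀ ℕ // particleNumber n = N} =>
      Real.exp (-β * energy ε n)) :
    ∑' n : {n : ℕ →₀ ℕ // particleNumber n = N}, (n.1 j : ℝ) * Real.exp (-β * energy ε n) ≤
      Real.exp (-β * (ε j - ε 0)) *
        (∑' n : {n : ℕ →₀ ℕ // particleNumber n = N}, (n.1 j : ℝ) * Real.exp (-β * energy ε n) +
          Z ε β N) := by
  set w := fun n : {n : ℕ →₀ ℕ // particleNumber n = N} => Real.exp (-β * energy ε n)
  have hw0 : ∀ n, 0 ≤ w n := fun n => (Real.exp_pos _).le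
  have hf : Summable fun n : {n : ℕ →₀ ℕ // particleNumber n = N} => (n.1 j : ℝ) * w n := by
    refine (hw.mul_left (N : ℝ)).of_nonneg_of_le
      (fun n => mul_nonneg (Nat.cast_nonneg _) (hw0 n)) fun n => ?_
    have : n.1 j ≤ N := (apply_le_particleNumber n.1 j).trans_eq n.2
    exact mul_le_mul_of_nonneg_right (by exact_mod_cast this) (hw0 n)
  let T : Set {n : ℕ →₀ ℕ // particleNumber n = N} := {n | 1 ≤ n.1 j}
  let e : T → {n : ℕ →₀ ℕ // particleNumber n = N} := fun n =>
    ⟨lowerParticle j n.1.1, (particleNumber_lowerParticle n.2).trans n.1.2⟩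
  have he : Function.Injective e := fun n m h =>
    Subtype.ext (Subtype.ext (lowerParticle_injOn j n.2 m.2 (congrArg Subtype.val h)))
  have hsupp : Function.support (fun n : {n : ℕ →₀ ℕ // particleNumber n = N} =>
      (n.1 j : ℝ) * w n) ⊆ T := by
    intro n hn
    exact Nat.one_le_iff_ne_zero.mpr fun h0 => hn (by simp [h0])
  rw [Z, ← hf.tsum_add hw, ← tsum_mul_left, ← tsum_subtype_eq_of_support_subset hsupp]
  refine Summable.tsum_le_tsum_of_inj e he (fun n _ => ?_) (fun n => le_of_eq ?_)
    (hf.subtype T) ((hf.add hw).mul_left _)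
  · have := hw0 n
    positivity
  · have hocc : ((lowerParticle j n.1.1 j : ℕ) : ℝ) + 1 = (n.1.1 j : ℝ) := by
      exact_mod_cast lowerParticle_apply_add_one hj n.2
    simp only [w, e]
    rw [energy_lowerParticle ε n.2, mul_add (-β), Real.exp_add, ← hocc]
    ring

/-- For every `β > 0` there is `c(β) > 0` such that for all `N` and every `j ≥ 1`, the
canonical Gibbs expectation of the occupation of the `j`-th level satisfies
`⟨n j⟩_N ≤ c(β) exp (-β (ε j - ε 0))`. -/
theorem expect_occupation_bound (ε : ℕ → ℝ) (hmono : Monotone ε) (hgap : ε 0 < ε 1)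
    (htrace : ∀ β : ℝ, 0 < β → Summable fun j => Real.exp (-β * ε j))
    (β : ℝ) (hβ : 0 < β) :
    ∃ c : ℝ, 0 < c ∧ ∀ N j : ℕ, 1 ≤ j →
      expect ε β N (fun n : ℕ →₀ ℕ => (n j : ℝ)) ≤
        c * Real.exp (-β * (ε j - ε 0)) := by
  have hq1 : Real.exp (-β * (ε 1 - ε 0)) < 1 :=
    Real.exp_lt_one_iff.mpr (by nlinarith)
  refine ⟨(1 - Real.exp (-β * (ε 1 - ε 0)))⁻¹, inv_pos.mpr (by linarith), fun N j hj => ?_⟩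
  have hq : Real.exp (-β * (ε j - ε 0)) ≤ Real.exp (-β * (ε 1 - ε 0)) :=
    Real.exp_le_exp.mpr (by nlinarith [hmono hj])
  have hZ : 0 ≤ Z ε β N := tsum_nonneg fun _ => (Real.exp_pos _).le
  have hrhs : 0 ≤ (1 - Real.exp (-β * (ε 1 - ε 0)))⁻¹ * Real.exp (-β * (ε j - ε 0)) :=
    mul_nonneg (inv_nonneg.mpr (by linarith)) (Real.exp_pos _).le
  by_cases hw : Summable fun n : {n : ℕ →₀ ℕ // particleNumber n = N} =>
      Real.exp (-β * energy ε n)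
  · refine div_le_of_le_mul₀ hZ hrhs ?_
    have hS := tsum_occupation_le ε β N hj hw
    have hS0 : 0 ≤ ∑' n : {n : ℕ →₀ ℕ // particleNumber n = N},
        (n.1 j : ℝ) * Real.exp (-β * energy ε n) := tsum_nonneg fun _ => by positivity
    rw [mul_assoc, inv_mul_eq_div, le_div_iff₀ (by linarith)]
    nlinarith [mul_le_mul_of_nonneg_right hq hS0]
  · rw [expect, Z, tsum_eq_zero_of_not_summable hw, div_zero]
    exact hrhs
end
end
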